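/- Conversely, suppose T=(T_k)∈𝒯 satisfies the system (difeq) for all x>0 and k≥1 (together with the initial conditions T_k(0)=1 built into the class 𝒯). Then for all x>0 and k≥1 the relation exp(∫₀ˣ log p(T_k(β)) dβ) + ∏_{i=1}^k q(T_i(x)) = 1 holds. -/

import Mathlib

open Set

/-- The standing hypotheses on `p, q` (with derivatives `p', q'`): `p, q` are
continuous on `[0,1]` and continuously differentiable on `(0,1]`, with
`p 0 = q 0 = 1`, `p 1 = q 1 = 0`, `p t > 0` for `t < 1`, `p' ≤ 0` and `q' < 0`
on `(0,1]`.  (In the duel `p = 1 - P₁`, `q = 1 - P₂`.) -/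
def PQContext (p q p' q' : ℝ → ℝ) : Prop :=
  ContinuousOn p (Icc 0 1) ∧ ContinuousOn q (Icc 0 1) ∧
  (∀ t ∈ Ioc (0 : ℝ) 1, HasDerivWithinAt p (p' t) (Ioc 0 1) t) ∧
  (∀ t ∈ Ioc (0 : ℝ) 1, HasDerivWithinAt q (q' t) (Ioc 0 1) t) ∧
  ContinuousOn p' (Ioc 0 1) ∧ ContinuousOn q' (Ioc 0 1) ∧
  p 0 = 1 ∧ q 0 = 1 ∧ p 1 = 0 ∧ q 1 = 0 ∧
  (∀ t ∈ Ico (0 : ℝ) 1, 0 < p t) ∧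
  (∀ t ∈ Ioc (0 : ℝ) 1, p' t ≤ 0) ∧ (∀ t ∈ Ioc (0 : ℝ) 1, q' t < 0)

/-- The class `𝒯` of sequences `(T_k)_{k ≥ 1}` of functions: continuous on `[0,∞)`,
continuously differentiable on `(0,∞)`, with `0 < T_k x ≤ 1`, `T_k' x < 0` and
`T_{k+1} x < T_k x` for `x > 0`, and `T_k 0 = 1`. -/
def IsClassT (T : ℕ → ℝ → ℝ) : Prop :=
  ∀ k, 1 ≤ k →
    ContinuousOn (T k) (Ici 0) ∧
    ContDiffOn ℝ 1 (T k) (Ioi 0) ∧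
    (∀ x, 0 ≤ x → 0 < T k x ∧ T k x ≤ 1) ∧
    (∀ x, 0 < x → deriv (T k) x < 0) ∧
    (∀ x, 0 < x → T (k + 1) x < T k x) ∧
    T k 0 = 1

/-- The right-hand side `φ_k(T₁(x), …, T_k(x))` of the `k`-th equation of the
system (difeq):
`-[(1 - ∏_{i=1}^k q(T_i x)) log p(T_k x) - q(T_k x)(1 - ∏_{i=1}^{k-1} q(T_i x)) log p(T_{k-1} x)]`
`/ (q'(T_k x) ∏_{i=1}^{k-1} q(T_i x))`.
For `k = 1` the products over `i ∈ [1,0]` are empty (equal to `1`), so the term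
containing `T₀` carries the factor `1 - 1 = 0` and is absent, giving
`T₁' = -(1 - q(T₁)) log p(T₁) / q'(T₁)`. -/
noncomputable def difeqRHS (p q q' : ℝ → ℝ) (T : ℕ → ℝ → ℝ) (k : ℕ) (x : ℝ) : ℝ :=
  -(((1 - ∏ i ∈ Finset.Icc 1 k, q (T i x)) * Real.log (p (T k x))
      - q (T k x) * (1 - ∏ i ∈ Finset.Icc 1 (k - 1), q (T i x)) *
          Real.log (p (T (k - 1) x)))
    / (q' (T k x) * ∏ i ∈ Finset.Icc 1 (k - 1), q (T i x)))

namespace PQContext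

variable {p q p' q' : ℝ → ℝ}

lemma q_strictAntiOn (h : PQContext p q p' q') : StrictAntiOn q (Icc 0 1) := by
  obtain ⟨-, hq, -, hq', -, -, -, -, -, -, -, -, hneg⟩ := h
  refine strictAntiOn_of_hasDerivWithinAt_neg (convex_Icc 0 1) hq (f' := q') ?_ ?_
  · intro t ht
    rw [interior_Icc] at ht ⊢
    exact (hq' t ⟨ht.1, ht.2.le⟩).mono Ioo_subset_Ioc_self
  · intro t ht
    rw [interior_Icc] at ht
    exact hneg t ⟨ht.1, ht.2.le⟩

lemma p_antitoneOn (h : PQContext p q p' q') : AntitoneOn p (Icc 0 1) := by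
  obtain ⟨hp, -, hp', -, -, -, -, -, -, -, -, hneg, -⟩ := h
  refine antitoneOn_of_hasDerivWithinAt_nonpos (convex_Icc 0 1) hp (f' := p') ?_ ?_
  · intro t ht
    rw [interior_Icc] at ht ⊢
    exact (hp' t ⟨ht.1, ht.2.le⟩).mono Ioo_subset_Ioc_self
  · intro t ht
    rw [interior_Icc] at ht
    exact hneg t ⟨ht.1, ht.2.le⟩

lemma q_mem_Ioo (h : PQContext p q p' q') {t : ℝ} (ht : t ∈ Ioo (0 : ℝ) 1) :
    q t ∈ Ioo (0 : ℝ) 1 := by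
  have hanti := h.q_strictAntiOn
  obtain ⟨-, -, -, -, -, -, -, hq0, -, hq1, -⟩ := h
  have h0 : (0 : ℝ) ∈ Icc (0 : ℝ) 1 := ⟨le_rfl, zero_le_one⟩
  have h1 : (1 : ℝ) ∈ Icc (0 : ℝ) 1 := ⟨zero_le_one, le_rfl⟩
  have ht' := Ioo_subset_Icc_self ht
  exact ⟨hq1 ▸ hanti ht' h1 ht.2, hq0 ▸ hanti h0 ht' ht.1⟩

lemma log_p_nonpos (h : PQContext p q p' q') {t : ℝ} (ht : t ∈ Ioo (0 : ℝ) 1) :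
    Real.log (p t) ≤ 0 := by
  have hanti := h.p_antitoneOn
  obtain ⟨-, -, -, -, -, -, hp0, -, -, -, hpos, -⟩ := h
  refine Real.log_nonpos (hpos t ⟨ht.1.le, ht.2⟩).le ?_
  exact hp0 ▸ hanti ⟨le_rfl, zero_le_one⟩ (Ioo_subset_Icc_self ht) ht.1.le

lemma hasDerivAt_q (h : PQContext p q p' q') {t : ℝ} (ht : t ∈ Ioo (0 : ℝ) 1) :
    HasDerivAt q (q' t) t := by
  obtain ⟨-, -, -, hq', -⟩ := h
  exact (hq' t ⟨ht.1, ht.2.le⟩).hasDerivAt (Ioc_mem_nhds ht.1 ht.2)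

lemma q'_neg (h : PQContext p q p' q') {t : ℝ} (ht : t ∈ Ioo (0 : ℝ) 1) : q' t < 0 := by
  obtain ⟨-, -, -, -, -, -, -, -, -, -, -, -, hneg⟩ := h
  exact hneg t ⟨ht.1, ht.2.le⟩

end PQContext

namespace IsClassT

variable {T : ℕ → ℝ → ℝ}

lemma mem_Ioo (hT : IsClassT T) {k : ℕ} (hk : 1 ≤ k) {x : ℝ} (hx : 0 < x) :
    T k x ∈ Ioo (0 : ℝ) 1 := by
  obtain ⟨hc, -, hb, hneg, -, h0⟩ := hT k hk
  have hanti : StrictAntiOn (T k) (Ici 0) :=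
    strictAntiOn_of_deriv_neg (convex_Ici 0) hc fun y hy => hneg y (by simpa using hy)
  exact ⟨(hb x hx.le).1, h0 ▸ hanti self_mem_Ici hx.le hx⟩

lemma differentiableAt (hT : IsClassT T) {k : ℕ} (hk : 1 ≤ k) {x : ℝ} (hx : 0 < x) :
    DifferentiableAt ℝ (T k) x :=
  ((hT k hk).2.1.differentiableOn one_ne_zero).differentiableAt (Ioi_mem_nhds hx)

end IsClassT

section

variable {p q p' q' : ℝ → ℝ} {T : ℕ → ℝ → ℝ}

lemma prod_q_pos (hpq : PQContext p q p' q') (hT : IsClassT T) (k : ℕ) {x : ℝ} (hx : 0 < x) :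
    0 < ∏ i ∈ Finset.Icc 1 k, q (T i x) :=
  Finset.prod_pos fun _ hi => (hpq.q_mem_Ioo (hT.mem_Ioo (Finset.mem_Icc.1 hi).1 hx)).1

lemma prod_q_lt_one (hpq : PQContext p q p' q') (hT : IsClassT T) {k : ℕ} (hk : 1 ≤ k)
    {x : ℝ} (hx : 0 < x) : ∏ i ∈ Finset.Icc 1 k, q (T i x) < 1 := by
  have hq : ∀ i ∈ Finset.Icc 1 k, q (T i x) ∈ Ioo (0 : ℝ) 1 := fun i hi =>
    hpq.q_mem_Ioo (hT.mem_Ioo (Finset.mem_Icc.1 hi).1 hx)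
  have h1 : 1 ∈ Finset.Icc 1 k := Finset.mem_Icc.2 ⟨le_rfl, hk⟩
  simpa using Finset.prod_lt_prod (fun i hi => (hq i hi).1) (fun i hi => (hq i hi).2.le)
    ⟨1, h1, (hq 1 h1).2⟩

lemma prod_q_zero (hpq : PQContext p q p' q') (hT : IsClassT T) {k : ℕ} (hk : 1 ≤ k) :
    ∏ i ∈ Finset.Icc 1 k, q (T i 0) = 0 := by
  obtain ⟨-, -, -, -, -, -, -, -, -, hq1, -⟩ := hpq
  refine Finset.prod_eq_zero (Finset.mem_Icc.2 ⟨hk, le_rfl⟩) ?_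
  rw [(hT k hk).2.2.2.2.2, hq1]

lemma continuousOn_prod_q (hpq : PQContext p q p' q') (hT : IsClassT T) (k : ℕ) :
    ContinuousOn (fun x => ∏ i ∈ Finset.Icc 1 k, q (T i x)) (Ici 0) := by
  refine continuousOn_finsetProd _ fun i hi => ?_
  obtain ⟨hc, -, hb, -⟩ := hT i (Finset.mem_Icc.1 hi).1
  exact hpq.2.1.comp hc fun x hx => ⟨(hb x hx).1.le, (hb x hx).2⟩

/-- Along a solution of the system, `1 - ∏_{i=1}^k q (T_i x)` has logarithmic derivative
`log p (T_k x)`. -/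
lemma hasDerivAt_prod_q (hpq : PQContext p q p' q') (hT : IsClassT T)
    (hode : ∀ x > (0 : ℝ), ∀ k, 1 ≤ k → deriv (T k) x = difeqRHS p q q' T k x)
    (k : ℕ) {x : ℝ} (hx : 0 < x) :
    HasDerivAt (fun y => ∏ i ∈ Finset.Icc 1 k, q (T i y))
      (-((1 - ∏ i ∈ Finset.Icc 1 k, q (T i x)) * Real.log (p (T k x)))) x := by
  induction k with
  | zero => simpa using hasDerivAt_const x (1 : ℝ)
  | succ k ih =>
    have hk : 1 ≤ k + 1 := Nat.le_add_left 1 k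
    have hmem := hT.mem_Ioo hk hx
    have hTd := (hT.differentiableAt hk hx).hasDerivAt
    rw [hode x hx _ hk] at hTd
    have hprod := ih.mul ((hpq.hasDerivAt_q hmem).comp x hTd)
    simp only [Finset.prod_Icc_succ_top hk]
    refine hprod.congr_deriv ?_
    have hQ := (prod_q_pos hpq hT k hx).ne'
    have hq' := (hpq.q'_neg hmem).ne
    simp only [difeqRHS, Finset.prod_Icc_succ_top hk, Nat.add_sub_cancel, Function.comp_apply]
    field_simp
    ring

end

/-- Conversely, if `T ∈ 𝒯` satisfies the system (difeq) for all
`x > 0` and `k ≥ 1` (together with the initial conditions `T_k 0 = 1` built into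
the class `𝒯`), then for all `x > 0` and `k ≥ 1` the relation
`exp (∫₀ˣ log p (T_k β) dβ) + ∏_{i=1}^k q (T_i x) = 1` holds. -/
theorem integral_relation_of_difeq
    (p q p' q' : ℝ → ℝ) (hpq : PQContext p q p' q')
    (T : ℕ → ℝ → ℝ) (hT : IsClassT T)
    (hode : ∀ x > (0 : ℝ), ∀ k, 1 ≤ k → deriv (T k) x = difeqRHS p q q' T k x) :
    ∀ x > (0 : ℝ), ∀ k, 1 ≤ k →
      Real.exp (∫ β in (0 : ℝ)..x, Real.log (p (T k β))) +
        (∏ i ∈ Finset.Icc 1 k, q (T i x)) = 1 := by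
  intro x hx k hk
  set F : ℝ → ℝ := fun y => 1 - ∏ i ∈ Finset.Icc 1 k, q (T i y) with hF
  have hpos : ∀ y, 0 ≤ y → 0 < F y := by
    intro y hy
    rcases hy.eq_or_lt with rfl | hy
    · simp [hF, prod_q_zero hpq hT hk]
    · exact sub_pos.2 (prod_q_lt_one hpq hT hk hy)
  have hcont : ContinuousOn (fun y => Real.log (F y)) (Icc 0 x) :=
    ((continuousOn_const.sub (continuousOn_prod_q hpq hT k)).mono Icc_subset_Ici_self).log
      fun y hy => (hpos y hy.1).ne'
  have hderiv : ∀ y ∈ Ioo 0 x,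
      HasDerivAt (fun y => Real.log (F y)) (Real.log (p (T k y))) y := by
    intro y hy
    have hne := (hpos y hy.1.le).ne'
    refine (((hasDerivAt_prod_q hpq hT hode k hy.1).const_sub 1).log hne).congr_deriv ?_
    change - -(F y * _) / F y = _
    field_simp
  have hint : IntervalIntegrable (fun y => Real.log (p (T k y))) MeasureTheory.volume 0 x := by
    have h := intervalIntegral.intervalIntegrable_deriv_of_nonneg
      (g := fun y => -Real.log (F y)) (g' := fun y => -Real.log (p (T k y))) (a := 0) (b := x)
      (by rw [uIcc_of_le hx.le]; exact hcont.neg)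
      (by rw [min_eq_left hx.le, max_eq_right hx.le]; exact fun y hy => (hderiv y hy).neg)
      (by
        rw [min_eq_left hx.le, max_eq_right hx.le]
        exact fun y hy => neg_nonneg.2 (hpq.log_p_nonpos (hT.mem_Ioo hk hy.1)))
    simpa [Pi.neg_def] using h.neg
  rw [intervalIntegral.integral_eq_sub_of_hasDerivAt_of_le hx.le hcont hderiv hint,
    Real.exp_sub, Real.exp_log (hpos x hx.le), Real.exp_log (hpos 0 le_rfl)]
  simp [hF, prod_q_zero hpq hT hk]
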